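/- Let P : ℝ^n → ℝ be convex and differentiable with ∇P Lipschitz continuous with constant h > 0. Decompose ℝ^n = ℝ^{n_1} × ⋯ × ℝ^{n_N}; for each i = 1,…,N let q_i : ℝ^{n_i} → (−∞, +∞] be proper, lower semicontinuous, and convex, let c_i > 0, and set Q(λ) = Σ_{i=1}^N q_i(λ_i) and Ψ = P + Q. Let D ∈ ℕ and τ : ℕ → ℕ satisfy 0 ≤ k − τ(k) ≤ D for all k. Let {λ(k)}_{k∈ℕ} be generated blockwise by λ_i(k+1) = prox^{c_i}_{q_i}[ λ_i(k) − c_i ∇_{λ_i} P(λ(τ(k))) ]. Then for every k ∈ ℕ and every λ ∈ ℝ^n, Ψ(λ(k+1)) − Ψ(λ) ≤ (h/2)‖λ(k+1) − λ(τ(k))‖² − Σ_{i=1}^N (1/(2c_i))‖λ_i(k+1) − λ_i(k)‖² + Σ_{i=1}^N (1/(2c_i))( ‖λ_i(k) − λ_i‖² − ‖λ_i(k+1) − λ_i‖² ). -/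

import Mathlib

open scoped RealInnerProductSpace
open Finset

noncomputable section

/-- A proper extended-real-valued function: never `⊥` and not identically `⊤`. -/
def ProperE {E : Type*} (f : E → EReal) : Prop :=
  (∀ x, f x ≠ ⊥) ∧ (∃ x, f x ≠ ⊤)

/-- Convexity for extended-real-valued functions. -/
def ERealConvexOn {E : Type*} [AddCommGroup E] [Module ℝ E] (f : E → EReal) : Prop :=
  ∀ x y : E, ∀ a b : ℝ, 0 ≤ a → 0 ≤ b → a + b = 1 →
    f (a • x + b • y) ≤ (a : EReal) * f x + (b : EReal) * f y

/-- The block decomposition `ℝ^n = ℝ^{n_1} × ⋯ × ℝ^{n_N}` with the Euclidean norm. -/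
abbrev Blk {N : ℕ} (dims : Fin N → ℕ) :=
  PiLp 2 (fun i : Fin N => EuclideanSpace ℝ (Fin (dims i)))

lemma EReal.coe_finsetSum {ι : Type*} (s : Finset ι) (f : ι → ℝ) :
    ((∑ i ∈ s, f i : ℝ) : EReal) = ∑ i ∈ s, (f i : EReal) := by
  classical
  induction s using Finset.induction_on with
  | empty => simp
  | insert a s ha ih => rw [Finset.sum_insert ha, Finset.sum_insert ha, EReal.coe_add, ih]

lemma EReal.finsetSum_ne_bot {ι : Type*} (s : Finset ι) (f : ι → EReal)
    (hf : ∀ i ∈ s, f i ≠ ⊥) : ∑ i ∈ s, f i ≠ ⊥ := by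
  classical
  induction s using Finset.induction_on with
  | empty => simp
  | insert a s ha ih =>
    rw [Finset.sum_insert ha, Ne, EReal.add_eq_bot_iff, not_or]
    exact ⟨hf a (Finset.mem_insert_self a s),
      ih fun i hi => hf i (Finset.mem_insert_of_mem hi)⟩

lemma EReal.finsetSum_eq_top {ι : Type*} (s : Finset ι) (f : ι → EReal)
    (hf : ∀ i ∈ s, f i ≠ ⊥) {j : ι} (hj : j ∈ s) (hfj : f j = ⊤) : ∑ i ∈ s, f i = ⊤ := by
  classical
  rw [← Finset.add_sum_erase s f hj, hfj]
  exact EReal.top_add_of_ne_bot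
    (EReal.finsetSum_ne_bot _ f fun i hi => hf i (Finset.mem_of_mem_erase hi))

section Gradient

variable {E : Type*} [NormedAddCommGroup E] [InnerProductSpace ℝ E] [CompleteSpace E]

lemma HasGradientAt.hasDerivAt_comp_add_smul {f : E → ℝ} {g x d : E} {t : ℝ}
    (hf : HasGradientAt f g (x + t • d)) :
    HasDerivAt (fun s : ℝ => f (x + s • d)) ⟪g, d⟫ t := by
  have hline : HasDerivAt (fun s : ℝ => x + s • d) d t := by
    simpa using ((hasDerivAt_id t).smul_const d).const_add x
  have := hf.hasFDerivAt.comp_hasDerivAt t hline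
  rw [InnerProductSpace.toDual_apply_apply] at this
  exact this

/-- First-order characterization of convexity. -/
lemma ConvexOn.add_inner_gradient_le {f : E → ℝ} (hf : ConvexOn ℝ Set.univ f) {g x : E}
    (hg : HasGradientAt f g x) (y : E) : f x + ⟪g, y - x⟫ ≤ f y := by
  have hconv : ConvexOn ℝ Set.univ (fun s : ℝ => f (x + s • (y - x))) := by
    have := hf.comp_affineMap (AffineMap.lineMap x y : ℝ →ᵃ[ℝ] E)
    refine this.congr fun s _ => ?_
    simp [AffineMap.lineMap_apply, add_comm]
  have hderiv : HasDerivAt (fun s : ℝ => f (x + s • (y - x))) ⟪g, y - x⟫ 0 :=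
    HasGradientAt.hasDerivAt_comp_add_smul (by simpa using hg)
  have := hconv.le_slope_of_hasDerivAt (Set.mem_univ 0) (Set.mem_univ 1) one_pos hderiv
  simp [slope_def_field] at this
  linarith

/-- The descent lemma for functions with Lipschitz gradient. -/
lemma le_add_inner_gradient_add_sq {f : E → ℝ} {g : E → E} {L : ℝ}
    (hf : ∀ x, HasGradientAt f (g x) x) (hg : ∀ x y, ‖g x - g y‖ ≤ L * ‖x - y‖) (x y : E) :
    f y ≤ f x + ⟪g x, y - x⟫ + L / 2 * ‖y - x‖ ^ 2 := by
  set d := y - x with hd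
  have hderiv (t : ℝ) : HasDerivAt
      (fun s : ℝ => f (x + s • d) - (s * ⟪g x, d⟫ + s ^ 2 * (L / 2 * ‖d‖ ^ 2)))
      (⟪g (x + t • d), d⟫ - (⟪g x, d⟫ + 2 * t * (L / 2 * ‖d‖ ^ 2))) t := by
    refine (hf (x + t • d)).hasDerivAt_comp_add_smul.sub (HasDerivAt.add ?_ ?_)
    · simpa using (hasDerivAt_id t).mul_const ⟪g x, d⟫
    · simpa using (hasDerivAt_pow 2 t).mul_const (L / 2 * ‖d‖ ^ 2)
  have hanti := antitoneOn_of_deriv_nonpos (convex_Icc (0 : ℝ) 1)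
    (fun t _ => (hderiv t).continuousAt.continuousWithinAt)
    (fun t _ => (hderiv t).differentiableAt.differentiableWithinAt) (fun t ht => by
      rw [interior_Icc] at ht
      rw [(hderiv t).deriv]
      have hinner : ⟪g (x + t • d) - g x, d⟫ ≤ L * (t * ‖d‖) * ‖d‖ := by
        refine (real_inner_le_norm _ _).trans ?_
        gcongr
        simpa [norm_smul, abs_of_pos ht.1] using hg (x + t • d) x
      rw [inner_sub_left] at hinner
      nlinarith)
  have h01 := hanti (Set.left_mem_Icc.2 zero_le_one) (Set.right_mem_Icc.2 zero_le_one) zero_le_one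
  simp [hd] at h01
  rw [← hd] at h01
  linarith

end Gradient

lemma ProperE.ne_top_of_add_coe_le {E : Type*} {f : E → EReal} (hf : ProperE f) {p : E}
    {ρ : E → ℝ} (hmin : ∀ u, f p + (ρ p : EReal) ≤ f u + (ρ u : EReal)) : f p ≠ ⊤ := by
  obtain ⟨u, hu⟩ := hf.2
  intro hp
  have := hmin u
  rw [hp, EReal.top_add_coe, top_le_iff] at this
  exact EReal.add_ne_top hu (EReal.coe_ne_top _) this

section Prox

variable {E : Type*} [NormedAddCommGroup E] [InnerProductSpace ℝ E]

lemma norm_sub_sq_convex_combination (p v w : E) (t : ℝ) :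
    ‖(1 - t) • p + t • v - w‖ ^ 2 =
      (1 - t) * ‖p - w‖ ^ 2 + t * ‖v - w‖ ^ 2 - t * (1 - t) * ‖v - p‖ ^ 2 := by
  have h₁ : (1 - t) • p + t • v - w = (1 - t) • (p - w) + t • (v - w) := by module
  have h₂ : v - p = (v - w) - (p - w) := by abel
  rw [h₁, h₂, norm_add_sq_real, norm_sub_sq_real (v - w), inner_smul_left, inner_smul_right,
    norm_smul, norm_smul, mul_pow, mul_pow, Real.norm_eq_abs, Real.norm_eq_abs, sq_abs, sq_abs,
    real_inner_comm (p - w)]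
  simp
  ring

/-- The quadratic growth of a convex function plus `r‖· - w‖²` around a minimizer `p`. -/
lemma ERealConvexOn.prox_inequality {f : E → EReal} (hf : ERealConvexOn f) {p v w : E}
    {r a b : ℝ} (ha : f p = a) (hb : f v = b)
    (hmin : ∀ u, f p + ((r * ‖p - w‖ ^ 2 : ℝ) : EReal) ≤ f u + ((r * ‖u - w‖ ^ 2 : ℝ) : EReal)) :
    a + r * ‖p - w‖ ^ 2 + r * ‖v - p‖ ^ 2 ≤ b + r * ‖v - w‖ ^ 2 := by
  have key (t : ℝ) (ht : t ∈ Set.Ioc (0 : ℝ) 1) :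
      a + r * ‖p - w‖ ^ 2 + (1 - t) * (r * ‖v - p‖ ^ 2) ≤ b + r * ‖v - w‖ ^ 2 := by
    have h₁ := hf p v (1 - t) t (by linarith [ht.2]) ht.1.le (by ring)
    have h₂ := (hmin ((1 - t) • p + t • v)).trans (add_le_add_left h₁ _)
    rw [ha, hb, norm_sub_sq_convex_combination] at h₂
    norm_cast at h₂
    refine le_of_mul_le_mul_left ?_ ht.1
    linarith
  have hlim : Filter.Tendsto
      (fun t : ℝ => a + r * ‖p - w‖ ^ 2 + (1 - t) * (r * ‖v - p‖ ^ 2)) (nhdsWithin 0 (Set.Ioi 0))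
      (nhds (a + r * ‖p - w‖ ^ 2 + r * ‖v - p‖ ^ 2)) := by
    have : Continuous (fun t : ℝ => a + r * ‖p - w‖ ^ 2 + (1 - t) * (r * ‖v - p‖ ^ 2)) := by
      fun_prop
    simpa using (this.tendsto 0).mono_left nhdsWithin_le_nhds
  refine le_of_tendsto hlim ?_
  filter_upwards [Ioc_mem_nhdsGT (zero_lt_one' ℝ)] with t ht using key t ht

/-- The basic inequality of a proximal gradient step with step size `c`. -/
lemma ERealConvexOn.prox_gradient_inequality {f : E → EReal} (hf : ERealConvexOn f)
    {p v x g : E} {c a b : ℝ} (hc : 0 < c) (ha : f p = a) (hb : f v = b)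
    (hmin : ∀ u, f p + ((1 / (2 * c) * ‖p - (x - c • g)‖ ^ 2 : ℝ) : EReal)
      ≤ f u + ((1 / (2 * c) * ‖u - (x - c • g)‖ ^ 2 : ℝ) : EReal)) :
    a - b ≤ ⟪g, v - p⟫ - 1 / (2 * c) * ‖p - x‖ ^ 2
      + 1 / (2 * c) * (‖x - v‖ ^ 2 - ‖p - v‖ ^ 2) := by
  have hprox := hf.prox_inequality ha hb hmin
  have hexpand (u : E) : 1 / (2 * c) * ‖u - (x - c • g)‖ ^ 2 =
      1 / (2 * c) * ‖u - x‖ ^ 2 + ⟪g, u - x⟫ + c / 2 * ‖g‖ ^ 2 := by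
    rw [show u - (x - c • g) = (u - x) + c • g by abel, norm_add_sq_real, inner_smul_right,
      norm_smul, mul_pow, Real.norm_eq_abs, sq_abs, real_inner_comm]
    field_simp
  have hsplit : ⟪g, v - p⟫ = ⟪g, v - x⟫ - ⟪g, p - x⟫ := by
    rw [← inner_sub_right, sub_sub_sub_cancel_right]
  rw [hexpand, hexpand, norm_sub_rev v x, norm_sub_rev v p] at hprox
  rw [hsplit]
  linarith

end Prox

/-- one-step inequality for the asynchronous blockwise proximal gradient
iteration `λᵢ(k+1) = prox^{cᵢ}_{qᵢ}[λᵢ(k) − cᵢ∇_{λᵢ}P(λ(τ(k)))]`: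
for all `k` and all `λ`, with `Ψ = P + Σᵢ qᵢ`,
`Ψ(λ(k+1)) − Ψ(λ) ≤ (h/2)‖λ(k+1) − λ(τ(k))‖² − Σᵢ (1/(2cᵢ))‖λᵢ(k+1) − λᵢ(k)‖²
  + Σᵢ (1/(2cᵢ))(‖λᵢ(k) − λᵢ‖² − ‖λᵢ(k+1) − λᵢ‖²)`. -/
theorem stmt10 {N : ℕ} (dims : Fin N → ℕ) (h : ℝ) (hh : 0 < h)
    (P : Blk dims → ℝ) (gradP : Blk dims → Blk dims)
    (hPconv : ConvexOn ℝ Set.univ P)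
    (hPdiff : ∀ x, HasGradientAt P (gradP x) x)
    (hLip : ∀ u v : Blk dims, ‖gradP u - gradP v‖ ≤ h * ‖u - v‖)
    (q : ∀ i : Fin N, EuclideanSpace ℝ (Fin (dims i)) → EReal)
    (hqproper : ∀ i, ProperE (q i)) (hqlsc : ∀ i, LowerSemicontinuous (q i))
    (hqconv : ∀ i, ERealConvexOn (q i))
    (c : Fin N → ℝ) (hc : ∀ i, 0 < c i)
    (D : ℕ) (τ : ℕ → ℕ) (hτ : ∀ k : ℕ, τ k ≤ k ∧ k - τ k ≤ D)
    (lam : ℕ → Blk dims)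
    (hiter : ∀ (k : ℕ) (i : Fin N), ∀ v : EuclideanSpace ℝ (Fin (dims i)),
      q i (lam (k + 1) i) +
          ((1 / (2 * c i) *
            ‖lam (k + 1) i - (lam k i - c i • gradP (lam (τ k)) i)‖ ^ 2 : ℝ) : EReal)
        ≤ q i v +
          ((1 / (2 * c i) * ‖v - (lam k i - c i • gradP (lam (τ k)) i)‖ ^ 2 : ℝ) : EReal)) :
    ∀ (k : ℕ) (μ : Blk dims),
      ((P (lam (k + 1)) : EReal) + ∑ i : Fin N, q i (lam (k + 1) i)) -
          ((P μ : EReal) + ∑ i : Fin N, q i (μ i))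
        ≤ ((h / 2 * ‖lam (k + 1) - lam (τ k)‖ ^ 2
            - (∑ i : Fin N, 1 / (2 * c i) * ‖lam (k + 1) i - lam k i‖ ^ 2)
            + ∑ i : Fin N, 1 / (2 * c i) *
                (‖lam k i - μ i‖ ^ 2 - ‖lam (k + 1) i - μ i‖ ^ 2) : ℝ) : EReal) := by
  intro k μ
  have hbot (x : Blk dims) (i : Fin N) : q i (x i) ≠ ⊥ := (hqproper i).1 _
  by_cases htop : ∃ j, q j (μ j) = ⊤
  · obtain ⟨j, hj⟩ := htop
    rw [EReal.finsetSum_eq_top _ _ (fun i _ => hbot μ i) (Finset.mem_univ j) hj,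
      EReal.coe_add_top, EReal.sub_top]
    exact bot_le
  push Not at htop
  have hnext (i : Fin N) : q i (lam (k + 1) i) ≠ ⊤ :=
    (hqproper i).ne_top_of_add_coe_le
      (ρ := fun v => 1 / (2 * c i) * ‖v - (lam k i - c i • gradP (lam (τ k)) i)‖ ^ 2) (hiter k i)
  have ha (i : Fin N) : q i (lam (k + 1) i) = ((q i (lam (k + 1) i)).toReal : EReal) :=
    (EReal.coe_toReal (hnext i) (hbot _ i)).symm
  have hb (i : Fin N) : q i (μ i) = ((q i (μ i)).toReal : EReal) :=
    (EReal.coe_toReal (htop i) (hbot _ i)).symm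
  rw [Finset.sum_congr rfl fun i _ => ha i, Finset.sum_congr rfl fun i _ => hb i,
    ← EReal.coe_finsetSum, ← EReal.coe_finsetSum, ← EReal.coe_add, ← EReal.coe_add,
    ← EReal.coe_sub, EReal.coe_le_coe_iff]
  have hsum := Finset.sum_le_sum fun i (_ : i ∈ Finset.univ) =>
    (hqconv i).prox_gradient_inequality (hc i) (ha i) (hb i) (hiter k i)
  rw [Finset.sum_sub_distrib, Finset.sum_add_distrib, Finset.sum_sub_distrib] at hsum
  have hinner : ∑ i, ⟪gradP (lam (τ k)) i, μ i - lam (k + 1) i⟫ =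
      ⟪gradP (lam (τ k)), μ - lam (τ k)⟫ - ⟪gradP (lam (τ k)), lam (k + 1) - lam (τ k)⟫ := by
    rw [← inner_sub_right, sub_sub_sub_cancel_right, PiLp.inner_apply]
    rfl
  have hdescent := le_add_inner_gradient_add_sq hPdiff hLip (lam (τ k)) (lam (k + 1))
  have hconvex := hPconv.add_inner_gradient_le (hPdiff (lam (τ k))) μ
  linarith
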